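/- For n ≥ 1 and β > 0 let σ^β_{[n]} denote the Curie–Weiss model: the probability measure on {−1,1}^n given by P[σ] proportional to exp((β/n)·Σ_{1≤i<j≤n} σ_i σ_j). Let H denote base-2 Shannon entropy of the full configuration. (1) For every β ∈ (0,1) there exists a constant C_β < ∞ such that H(σ^β_{[n]}) ≥ n − C_β for all n. (2) For β = 1 there exists an absolute constant C < ∞ such that H(σ^1_{[n]}) ≥ n − C·√n for all n. -/

import Mathlib

open Finset

namespace SR

/-- The spin `±1 ∈ ℝ` associated to a Boolean value. -/
noncomputable def spinR (b : Bool) : ℝ := if b then 1 else -1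

/-- The Curie–Weiss measure at inverse temperature `β` on `n` sites:
`P[σ] ∝ exp((β/n)·Σ_{i<j} σ_i σ_j)`. -/
noncomputable def cwPMF (n : ℕ) (β : ℝ) : (Fin n → Bool) → ℝ := fun σ =>
  Real.exp (β / n * ∑ q ∈ univ.filter (fun q : Fin n × Fin n => q.1 < q.2),
      spinR (σ q.1) * spinR (σ q.2)) /
    ∑ τ : Fin n → Bool,
      Real.exp (β / n * ∑ q ∈ univ.filter (fun q : Fin n × Fin n => q.1 < q.2),
        spinR (τ q.1) * spinR (τ q.2))

/-- Base-2 Shannon entropy of the full Curie–Weiss configuration.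
(Note `Real.logb 2 0 = 0`, so the `0·log 0 = 0` convention holds automatically.) -/
noncomputable def cwEntropy (n : ℕ) (β : ℝ) : ℝ :=
  - ∑ σ : Fin n → Bool, cwPMF n β σ * Real.logb 2 (cwPMF n β σ)

end SR

namespace SR

/-! ### Bounds on the hyperbolic tangent -/

lemma sinh_add_cube_le {x : ℝ} (hx : 0 ≤ x) :
    Real.sinh x + x ^ 3 / 3 ≤ x * Real.cosh x := by
  have hmono : MonotoneOn (fun y : ℝ => y * Real.cosh y - Real.sinh y - y ^ 3 / 3)
      (Set.Ici 0) := by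
    have hd : ∀ y : ℝ, HasDerivAt (fun y : ℝ => y * Real.cosh y - Real.sinh y - y ^ 3 / 3)
        (y * Real.sinh y - y ^ 2) y := by
      intro y
      have h := (((hasDerivAt_id y).mul (Real.hasDerivAt_cosh y)).sub
        (Real.hasDerivAt_sinh y)).sub ((hasDerivAt_pow 3 y).div_const 3)
      refine HasDerivAt.congr_deriv h ?_
      simp only [id_eq]
      push_cast
      ring
    refine monotoneOn_of_deriv_nonneg (convex_Ici 0)
      (fun y _ => (hd y).continuousAt.continuousWithinAt)
      (fun y _ => (hd y).differentiableAt.differentiableWithinAt) fun y hy => ?_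
    rw [interior_Ici] at hy
    have hy0 : 0 ≤ y := le_of_lt hy
    rw [(hd y).deriv]
    nlinarith [Real.self_le_sinh_iff.2 hy0]
  have h := hmono (Set.mem_Ici.2 le_rfl) (Set.mem_Ici.2 hx) hx
  simp at h
  linarith

lemma mul_tanh_le_sq (x : ℝ) : x * Real.tanh x ≤ x ^ 2 := by
  wlog hx : 0 ≤ x generalizing x
  · simpa [Real.tanh_neg] using this (-x) (by linarith)
  have h := sinh_add_cube_le hx
  have ht : Real.tanh x ≤ x := by
    rw [Real.tanh_eq_sinh_div_cosh, div_le_iff₀ (Real.cosh_pos x)]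
    have : 0 ≤ x ^ 3 / 3 := by positivity
    linarith
  nlinarith

lemma mul_tanh_le_sq_sub_pow_four {x : ℝ} (h1 : |x| ≤ 1) :
    x * Real.tanh x ≤ x ^ 2 - x ^ 4 / 9 := by
  wlog hx : 0 ≤ x generalizing x
  · have := this (x := -x) (by simpa using h1) (by linarith)
    simpa [Real.tanh_neg, Even.neg_pow (show Even 4 by decide)] using this
  have h := sinh_add_cube_le hx
  have hx1 : x ≤ 1 := (le_abs_self x).trans h1
  have hc : Real.cosh x ≤ 3 := by
    have h2 := Real.exp_le_exp.2 hx1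
    have h3 := Real.exp_one_lt_d9
    have h4 : Real.exp (-x) ≤ 1 := Real.exp_le_one_iff.2 (by linarith)
    rw [Real.cosh_eq]
    linarith
  have ht : Real.tanh x ≤ x - x ^ 3 / 9 := by
    rw [Real.tanh_eq_sinh_div_cosh, div_le_iff₀ (Real.cosh_pos x)]
    have : 0 ≤ x ^ 3 := by positivity
    nlinarith
  calc x * Real.tanh x ≤ x * (x - x ^ 3 / 9) := by gcongr
    _ = _ := by ring

/-! ### Magnetization and local field -/

variable {n : ℕ}

/-- The total magnetization of a configuration. -/
noncomputable def magnetization (σ : Fin n → Bool) : ℝ := ∑ i, spinR (σ i)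

/-- The magnetization of all sites other than `i`. -/
noncomputable def localField (i : Fin n) (σ : Fin n → Bool) : ℝ :=
  magnetization σ - spinR (σ i)

/-- The sum of `σ_i σ_j` over all pairs `i < j`. -/
noncomputable def pairSum (σ : Fin n → Bool) : ℝ :=
  ∑ q ∈ univ.filter (fun q : Fin n × Fin n => q.1 < q.2), spinR (σ q.1) * spinR (σ q.2)

/-- The unnormalized Curie–Weiss weight. -/
noncomputable def cwWeight (β : ℝ) (σ : Fin n → Bool) : ℝ := Real.exp (β / n * pairSum σ)

lemma cwWeight_pos (β : ℝ) (σ : Fin n → Bool) : 0 < cwWeight β σ := Real.exp_pos _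

lemma spinR_sq (b : Bool) : spinR b ^ 2 = 1 := by cases b <;> simp [spinR]

lemma spinR_not (b : Bool) : spinR (!b) = -spinR b := by cases b <;> simp [spinR]

lemma abs_spinR (b : Bool) : |spinR b| = 1 := by cases b <;> simp [spinR]

lemma two_mul_pairSum (σ : Fin n → Bool) : 2 * pairSum σ = magnetization σ ^ 2 - n := by
  have hswap : pairSum σ = ∑ q ∈ univ.filter (fun q : Fin n × Fin n => q.2 < q.1),
      spinR (σ q.1) * spinR (σ q.2) := by
    refine Finset.sum_nbij' Prod.swap Prod.swap ?_ ?_ ?_ ?_ ?_ <;> simp [mul_comm]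
  have hdiag : ∑ q ∈ univ.filter (fun q : Fin n × Fin n => q.1 = q.2),
      spinR (σ q.1) * spinR (σ q.2) = n := by
    rw [Finset.sum_filter, Fintype.sum_prod_type]
    simp [← sq, spinR_sq]
  have hall : magnetization σ ^ 2 =
      ∑ q : Fin n × Fin n, spinR (σ q.1) * spinR (σ q.2) := by
    rw [magnetization, sq, Finset.sum_mul_sum, Fintype.sum_prod_type]
  have hsplit : ∑ q : Fin n × Fin n, spinR (σ q.1) * spinR (σ q.2) =
      pairSum σ + ∑ q ∈ univ.filter (fun q : Fin n × Fin n => q.2 < q.1),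
        spinR (σ q.1) * spinR (σ q.2) +
      ∑ q ∈ univ.filter (fun q : Fin n × Fin n => q.1 = q.2),
        spinR (σ q.1) * spinR (σ q.2) := by
    rw [pairSum, Finset.sum_filter, Finset.sum_filter, Finset.sum_filter,
      ← Finset.sum_add_distrib, ← Finset.sum_add_distrib]
    refine Finset.sum_congr rfl fun q _ => ?_
    rcases lt_trichotomy q.1 q.2 with h | h | h
    · simp [h, h.not_gt, h.ne]
    · simp [h]
    · simp [h, h.not_gt, h.ne']
  linarith

lemma localField_eq_sum_erase (i : Fin n) (σ : Fin n → Bool) :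
    localField i σ = ∑ j ∈ univ.erase i, spinR (σ j) := by
  rw [localField, magnetization, ← Finset.add_sum_erase _ _ (mem_univ i)]
  ring

lemma abs_localField_le (i : Fin n) (σ : Fin n → Bool) : |localField i σ| ≤ n := by
  rw [localField_eq_sum_erase]
  refine (Finset.abs_sum_le_sum_abs _ _).trans ?_
  simp [abs_spinR]

lemma sum_localField_sq (σ : Fin n → Bool) :
    ∑ i, localField i σ ^ 2 = (n - 2) * magnetization σ ^ 2 + n := by
  have h : ∀ i, localField i σ ^ 2 =
      magnetization σ ^ 2 - 2 * magnetization σ * spinR (σ i) + 1 := fun i => by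
    rw [localField, sub_sq, spinR_sq]
  simp only [h, Finset.sum_add_distrib, Finset.sum_sub_distrib, ← Finset.mul_sum]
  rw [← magnetization]
  simp
  ring

lemma sum_spinR_mul_localField (σ : Fin n → Bool) :
    ∑ i, spinR (σ i) * localField i σ = magnetization σ ^ 2 - n := by
  have h : ∀ i, spinR (σ i) * localField i σ = spinR (σ i) * magnetization σ - 1 :=
    fun i => by rw [localField, mul_sub, ← sq, spinR_sq]
  simp only [h, Finset.sum_sub_distrib, ← Finset.sum_mul]
  rw [← magnetization]
  simp
  ring

lemma pairSum_eq (i : Fin n) (σ : Fin n → Bool) :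
    pairSum σ = spinR (σ i) * localField i σ + (localField i σ ^ 2 + 1 - n) / 2 := by
  have h := two_mul_pairSum σ
  have hs := spinR_sq (σ i)
  rw [localField]
  linear_combination h / 2 + hs / 2

/-- The configuration with the spin at `i` reversed. -/
def flip (i : Fin n) (σ : Fin n → Bool) : Fin n → Bool := Function.update σ i (!σ i)

lemma flip_involutive (i : Fin n) : Function.Involutive (flip i) := fun σ => by
  simp [flip]

lemma flip_apply_self (i : Fin n) (σ : Fin n → Bool) : flip i σ i = !σ i := by simp [flip]

lemma localField_flip (i : Fin n) (σ : Fin n → Bool) :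
    localField i (flip i σ) = localField i σ := by
  rw [localField_eq_sum_erase, localField_eq_sum_erase]
  refine Finset.sum_congr rfl fun j hj => ?_
  rw [flip, Function.update_of_ne (Finset.ne_of_mem_erase hj)]

/-- Conditionally on the other spins, the mean of `σ_i` is `tanh` of the scaled local field. -/
lemma sum_cwWeight_mul_spin_sub_tanh (β : ℝ) (i : Fin n) :
    ∑ σ : Fin n → Bool, cwWeight β σ * (spinR (σ i) * localField i σ -
      localField i σ * Real.tanh (β / n * localField i σ)) = 0 := by
  set f : (Fin n → Bool) → ℝ := fun σ => cwWeight β σ * (spinR (σ i) * localField i σ -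
      localField i σ * Real.tanh (β / n * localField i σ)) with hf
  have hcancel : ∀ σ, f σ + f (flip i σ) = 0 := by
    intro σ
    simp only [hf, cwWeight, pairSum_eq i, localField_flip, flip_apply_self, spinR_not]
    set m := localField i σ
    set u := β / n * m with hu
    set K := β / n * ((m ^ 2 + 1 - n) / 2) with hK
    have h1 : ∀ s : ℝ, β / n * (s * m + (m ^ 2 + 1 - n) / 2) = s * u + K := fun s => by
      rw [hu, hK]; ring
    have hc := (Real.cosh_pos u).ne'
    have hb : Real.exp u * (1 - Real.tanh u) = Real.exp (-u) * (1 + Real.tanh u) := by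
      rw [Real.tanh_eq_sinh_div_cosh]
      field_simp
      rw [← Real.cosh_add_sinh, ← Real.cosh_sub_sinh]
      ring
    rw [h1, h1, Real.exp_add, Real.exp_add]
    cases σ i <;> simp only [spinR] <;> norm_num <;>
      linear_combination (Real.exp K * m) * hb
  have hsum : ∑ σ, f (flip i σ) = ∑ σ, f σ :=
    Equiv.sum_comp (flip_involutive i).toPerm f
  have : ∑ σ, (f σ + f (flip i σ)) = 0 := Finset.sum_eq_zero fun σ _ => hcancel σ
  rw [Finset.sum_add_distrib, hsum] at this
  linarith

lemma sum_cwWeight_mul_magnetization_sq_sub (β : ℝ) :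
    ∑ σ : Fin n → Bool, cwWeight β σ * (magnetization σ ^ 2 - n -
      ∑ i, localField i σ * Real.tanh (β / n * localField i σ)) = 0 := by
  have h := Finset.sum_eq_zero fun (i : Fin n) (_ : i ∈ univ) =>
    sum_cwWeight_mul_spin_sub_tanh β i
  rw [Finset.sum_comm] at h
  simpa only [← Finset.mul_sum, Finset.sum_sub_distrib, sum_spinR_mul_localField] using h

/-! ### Second moment of the magnetization -/

lemma sum_cwWeight_mul_magnetization_sq_le_of_lt_one (hn : 1 ≤ n) {β : ℝ} (hβ : 0 < β)
    (hβ1 : β < 1) :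
    ∑ σ : Fin n → Bool, cwWeight β σ * magnetization σ ^ 2 ≤
      2 / (1 - β) * n * ∑ σ : Fin n → Bool, cwWeight β σ := by
  have hn' : (1 : ℝ) ≤ n := by exact_mod_cast hn
  have hβ2 : 0 < 1 - β := by linarith
  have key : ∀ σ : Fin n → Bool, (1 - β) * magnetization σ ^ 2 - 2 * n ≤
      magnetization σ ^ 2 - n -
        ∑ i, localField i σ * Real.tanh (β / n * localField i σ) := by
    intro σ
    have h1 : ∑ i, localField i σ * Real.tanh (β / n * localField i σ) ≤
        ∑ i, β / n * localField i σ ^ 2 := by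
      refine Finset.sum_le_sum fun i _ => ?_
      have hb : 0 < β / n := by positivity
      refine le_of_mul_le_mul_left ?_ hb
      calc _ = (β / n * localField i σ) * Real.tanh (β / n * localField i σ) := by ring
        _ ≤ _ := mul_tanh_le_sq _
        _ = _ := by ring
    rw [← Finset.mul_sum, sum_localField_sq] at h1
    have h2 : β / n * ((n - 2) * magnetization σ ^ 2 + n) =
        β * magnetization σ ^ 2 + β - 2 * (β / n * magnetization σ ^ 2) := by
      field_simp
      ring
    have h3 : 0 ≤ β / n * magnetization σ ^ 2 := by positivity
    linarith
  have h0 := sum_cwWeight_mul_magnetization_sq_sub (n := n) β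
  have h1 := Finset.sum_le_sum fun (σ : Fin n → Bool) (_ : σ ∈ univ) =>
    mul_le_mul_of_nonneg_left (key σ) (cwWeight_pos β σ).le
  rw [h0] at h1
  have h2 : ∑ σ : Fin n → Bool, cwWeight β σ * ((1 - β) * magnetization σ ^ 2 - 2 * n) =
      (1 - β) * ∑ σ : Fin n → Bool, cwWeight β σ * magnetization σ ^ 2 -
        2 * n * ∑ σ : Fin n → Bool, cwWeight β σ := by
    rw [Finset.mul_sum, Finset.mul_sum, ← Finset.sum_sub_distrib]
    exact Finset.sum_congr rfl fun σ _ => by ring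
  rw [h2] at h1
  rw [div_mul_eq_mul_div, div_mul_eq_mul_div, le_div_iff₀ hβ2]
  linarith

lemma sum_cwWeight_one_mul_magnetization_sq_le (hn : 1 ≤ n) :
    ∑ σ : Fin n → Bool, cwWeight 1 σ * magnetization σ ^ 2 ≤
      21 * Real.sqrt n * n * ∑ σ : Fin n → Bool, cwWeight 1 σ := by
  have hn' : (1 : ℝ) ≤ n := by exact_mod_cast hn
  have hn0 : (0 : ℝ) < n := by linarith
  set a : ℝ := n * Real.sqrt n with ha
  have ha2 : a ^ 2 = (n : ℝ) ^ 3 := by rw [ha, mul_pow, Real.sq_sqrt hn0.le]; ring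
  have ha1 : 1 ≤ a := one_le_mul_of_one_le_of_one_le hn' (Real.one_le_sqrt.2 hn')
  have key : ∀ σ : Fin n → Bool, a / (9 * n ^ 2) * (magnetization σ ^ 2 - 21 * a) ≤
      magnetization σ ^ 2 - n -
        ∑ i, localField i σ * Real.tanh (1 / n * localField i σ) := by
    intro σ
    have h1 : ∑ i, localField i σ * Real.tanh (1 / n * localField i σ) ≤
        ∑ i, (1 / n * localField i σ ^ 2 -
          (a * magnetization σ ^ 2 - 2 * a - a ^ 2) / (9 * n ^ 3)) := by
      refine Finset.sum_le_sum fun i _ => ?_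
      have hm := abs_localField_le i σ
      have hs := spinR_sq (σ i)
      have hS : magnetization σ ^ 2 ≤ 2 * localField i σ ^ 2 + 2 := by
        rw [localField]
        nlinarith [sq_nonneg (magnetization σ - 2 * spinR (σ i))]
      set m := localField i σ
      have h4 : a * magnetization σ ^ 2 - 2 * a - a ^ 2 ≤ m ^ 4 := by
        nlinarith [sq_nonneg (m ^ 2 - a)]
      have ht := mul_tanh_le_sq_sub_pow_four (x := 1 / n * m) (by
        rw [abs_mul, abs_of_pos (by positivity : (0 : ℝ) < 1 / n), one_div,
          inv_mul_le_iff₀ hn0]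
        simpa using hm)
      calc m * Real.tanh (1 / n * m) = n * (1 / n * m * Real.tanh (1 / n * m)) := by
            field_simp
        _ ≤ n * ((1 / n * m) ^ 2 - (1 / n * m) ^ 4 / 9) := by gcongr
        _ = 1 / n * m ^ 2 - m ^ 4 / (9 * n ^ 3) := by field_simp
        _ ≤ _ := by gcongr
    rw [Finset.sum_sub_distrib, ← Finset.mul_sum, sum_localField_sq] at h1
    simp only [Finset.sum_const, card_univ, Fintype.card_fin, nsmul_eq_mul] at h1
    have h2 : 1 / n * ((n - 2) * magnetization σ ^ 2 + n) =
        magnetization σ ^ 2 + 1 - 2 * (1 / n * magnetization σ ^ 2) := by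
      field_simp
      ring
    have h3 : 0 ≤ 1 / n * magnetization σ ^ 2 := by positivity
    have h5 : n * ((a * magnetization σ ^ 2 - 2 * a - a ^ 2) / (9 * n ^ 3)) =
        a / (9 * n ^ 2) * (magnetization σ ^ 2 - 21 * a) +
          (20 * a ^ 2 - 2 * a) / (9 * n ^ 2) := by
      field_simp
      ring
    have h6 : (n : ℝ) + 1 ≤ (20 * a ^ 2 - 2 * a) / (9 * n ^ 2) := by
      rw [le_div_iff₀ (by positivity)]
      have : 18 * a ^ 2 ≤ 20 * a ^ 2 - 2 * a := by nlinarith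
      refine le_trans ?_ this
      rw [ha2]
      nlinarith [sq_nonneg (n : ℝ)]
    linarith
  have h0 := sum_cwWeight_mul_magnetization_sq_sub (n := n) 1
  have h1 := Finset.sum_le_sum fun (σ : Fin n → Bool) (_ : σ ∈ univ) =>
    mul_le_mul_of_nonneg_left (key σ) (cwWeight_pos 1 σ).le
  rw [h0] at h1
  have h2 : ∑ σ : Fin n → Bool,
        cwWeight 1 σ * (a / (9 * n ^ 2) * (magnetization σ ^ 2 - 21 * a)) =
      a / (9 * n ^ 2) * (∑ σ : Fin n → Bool, cwWeight 1 σ * magnetization σ ^ 2 -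
        21 * a * ∑ σ : Fin n → Bool, cwWeight 1 σ) := by
    rw [Finset.mul_sum, ← Finset.sum_sub_distrib, Finset.mul_sum]
    exact Finset.sum_congr rfl fun σ _ => by ring
  rw [h2] at h1
  have h3 := nonpos_of_mul_nonpos_right h1 (by positivity)
  rw [ha] at h3
  linarith

/-! ### Entropy -/

/-- A bound on the second moment of the magnetization bounds the entropy deficit. -/
lemma le_cwEntropy (hn : 1 ≤ n) {β B : ℝ} (hβ : 0 < β)
    (hB : ∑ σ : Fin n → Bool, cwWeight β σ * magnetization σ ^ 2 ≤
      B * n * ∑ σ : Fin n → Bool, cwWeight β σ) :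
    (n : ℝ) - β * B / (2 * Real.log 2) ≤ cwEntropy n β := by
  have hn0 : (0 : ℝ) < n := by exact_mod_cast hn
  have hl : 0 < Real.log 2 := Real.log_pos one_lt_two
  set Z := ∑ σ : Fin n → Bool, cwWeight β σ with hZ
  have hZ0 : 0 < Z := Finset.sum_pos (fun σ _ => cwWeight_pos β σ) univ_nonempty
  have hA : ∀ σ : Fin n → Bool,
      β / n * pairSum σ = β / (2 * n) * magnetization σ ^ 2 - β / 2 := fun σ => by
    have : pairSum σ = (magnetization σ ^ 2 - n) / 2 := by linarith [two_mul_pairSum σ]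
    rw [this]
    field_simp
  have hlogZ : n * Real.log 2 - β / 2 ≤ Real.log Z := by
    have h : (2 : ℝ) ^ n * Real.exp (-(β / 2)) ≤ Z := by
      calc (2 : ℝ) ^ n * Real.exp (-(β / 2)) =
            ∑ _σ : Fin n → Bool, Real.exp (-(β / 2)) := by simp
        _ ≤ Z := Finset.sum_le_sum fun σ _ => by
            rw [cwWeight, hA]
            have : 0 ≤ β / (2 * n) * magnetization σ ^ 2 := by positivity
            exact Real.exp_le_exp.2 (by linarith)
    have h2 := Real.log_le_log (by positivity) h
    rw [Real.log_mul (by positivity) (Real.exp_pos _).ne', Real.log_pow, Real.log_exp] at h2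
    linarith
  have hp : ∀ σ : Fin n → Bool, cwPMF n β σ = cwWeight β σ / Z := fun σ => rfl
  have hH : cwEntropy n β = (Real.log Z + β / 2 -
      β / (2 * n) * (∑ σ : Fin n → Bool, cwWeight β σ * magnetization σ ^ 2) / Z) /
        Real.log 2 := by
    have h : ∀ σ : Fin n → Bool, cwPMF n β σ * Real.logb 2 (cwPMF n β σ) =
        (β / (2 * n) / Z * (cwWeight β σ * magnetization σ ^ 2) -
          (β / 2 + Real.log Z) / Z * cwWeight β σ) / Real.log 2 := fun σ => by
      rw [hp, Real.logb, Real.log_div (cwWeight_pos β σ).ne' hZ0.ne']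
      conv_lhs => rw [show Real.log (cwWeight β σ) = _ from Real.log_exp _, hA]
      ring
    rw [cwEntropy, Finset.sum_congr rfl fun σ _ => h σ, ← Finset.sum_div,
      Finset.sum_sub_distrib, ← Finset.mul_sum, ← Finset.mul_sum, ← hZ]
    field_simp
    ring
  have hE : β / (2 * n) * (∑ σ : Fin n → Bool, cwWeight β σ * magnetization σ ^ 2) / Z ≤
      β * B / 2 := by
    rw [div_le_iff₀ hZ0]
    calc _ ≤ β / (2 * n) * (B * n * Z) := by gcongr
      _ = _ := by field_simp
  rw [hH, le_div_iff₀ hl, sub_mul]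
  have : β * B / (2 * Real.log 2) * Real.log 2 = β * B / 2 := by field_simp
  linarith

end SR

open SR

/-- **The entropy of the (sub)critical Curie–Weiss model is large**
(Proposition 7.3 of the paper):
(1) for `0 < β < 1` there is a constant `C_β` with `H(σ^β_{[n]}) ≥ n − C_β` for all `n ≥ 1`;
(2) at `β = 1` there is an absolute constant `C` with `H(σ^1_{[n]}) ≥ n − C·√n` for all
`n ≥ 1`. -/
theorem curie_weiss_entropy_large :
    (∀ β : ℝ, 0 < β → β < 1 →
      ∃ C : ℝ, ∀ n : ℕ, 1 ≤ n → (n : ℝ) - C ≤ cwEntropy n β) ∧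
    (∃ C : ℝ, ∀ n : ℕ, 1 ≤ n → (n : ℝ) - C * Real.sqrt n ≤ cwEntropy n 1) := by
  refine ⟨fun β hβ hβ1 => ⟨β * (2 / (1 - β)) / (2 * Real.log 2), fun n hn =>
    le_cwEntropy hn hβ (sum_cwWeight_mul_magnetization_sq_le_of_lt_one hn hβ hβ1)⟩,
    21 / (2 * Real.log 2), fun n hn => ?_⟩
  convert le_cwEntropy hn one_pos (sum_cwWeight_one_mul_magnetization_sq_le hn) using 2
  ring
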